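/- If (A, B) is stabilizable, then for any ς > 0 there exists a symmetric positive definite matrix R such that AᵀR + RA − ς·R B Bᵀ R < −ς·I (Riccati inequality); moreover with K = BᵀR, for any η ≥ ς one has Aᵀ R + R A − η R B K ≤ −ς I in the Loewner order. -/

import Mathlib

open Matrix

section Auxiliary

variable {m : Type*} [Fintype m] [DecidableEq m]

/-- Positive definiteness is stable under small perturbations in a Hermitian direction. -/
lemma Matrix.PosDef.exists_pos_sub_smul {m : Type*} [Fintype m] {Q W : Matrix m m ℝ} (hQ : Q.PosDef)
    (hW : W.IsHermitian) : ∃ s : ℝ, 0 < s ∧ (Q - s • W).PosDef := by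
  have key : ∀ᶠ s : ℝ in nhds 0, ∀ x ∈ Metric.sphere (0 : m → ℝ) 1,
      0 < x ⬝ᵥ (Q - s • W) *ᵥ x := by
    refine (isCompact_sphere (0 : m → ℝ) 1).eventually_forall_of_forall_eventually ?_
    intro x hx
    have hx0 : x ≠ 0 := by
      rintro rfl
      simp at hx
    have hc : Continuous fun z : ℝ × (m → ℝ) => z.2 ⬝ᵥ (Q - z.1 • W) *ᵥ z.2 := by
      fun_prop
    refine hc.continuousAt.eventually_mem (Ioi_mem_nhds ?_)
    simpa using (posDef_iff_dotProduct_mulVec.mp hQ).2 hx0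
  obtain ⟨s, hs, hs0⟩ := ((key.filter_mono nhdsWithin_le_nhds).and
    (self_mem_nhdsWithin (s := Set.Ioi (0 : ℝ)))).exists
  refine ⟨s, hs0, .of_dotProduct_mulVec_pos
    (hQ.isHermitian.sub (hW.smul (IsSelfAdjoint.all s))) fun x hx => ?_⟩
  have hn : 0 < ‖x‖ := norm_pos_iff.mpr hx
  have h := hs (‖x‖⁻¹ • x) (by simp [norm_smul, hn.ne'])
  rw [mulVec_smul, smul_dotProduct, dotProduct_smul, smul_smul, smul_eq_mul] at h
  simpa using pos_of_mul_pos_right h (by positivity)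

open scoped Matrix.Norms.L2Operator in
/-- A complex square matrix with spectrum in the open unit disc has a contractive power. -/
lemma Matrix.exists_norm_pow_lt_one (M : Matrix m m ℂ) (hM : ∀ z ∈ spectrum ℂ M, ‖z‖ < 1) :
    ∃ k : ℕ, 0 < k ∧ ‖M ^ k‖ < 1 := by
  rcases subsingleton_or_nontrivial (Matrix m m ℂ) with h | h
  · exact ⟨1, one_pos, by simp [Subsingleton.elim (M ^ 1) 0]⟩
  have hr : spectralRadius ℂ M < (1 : NNReal) :=
    spectrum.spectralRadius_lt_of_forall_lt M fun z hz => by exact_mod_cast hM z hz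
  obtain ⟨k, hk, hk0⟩ := (((spectrum.pow_nnnorm_pow_one_div_tendsto_nhds_spectralRadius
    M).eventually_lt_const hr).and (Filter.eventually_gt_atTop 0)).exists
  refine ⟨k, hk0, ?_⟩
  by_contra! hge
  refine hk.not_ge ?_
  refine ENNReal.one_le_rpow (by exact_mod_cast hge) (by positivity)

open scoped Matrix.Norms.L2Operator in
/-- If the complexification of a real matrix `N` is a strict contraction,
then `1 - N * Nᵀ` is positive definite. -/
lemma Matrix.posDef_one_sub_mul_transpose (N : Matrix m m ℝ)
    (hN : ‖N.map (fun x => (x : ℂ))‖ < 1) : (1 - N * Nᵀ).PosDef := by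
  refine .of_dotProduct_mulVec_pos ?_ fun x hx => ?_
  · simp [IsHermitian]
  set z : EuclideanSpace ℂ m := WithLp.toLp 2 fun i => (x i : ℂ) with hz
  have hz0 : 0 < ‖z‖ := by
    rw [norm_pos_iff]
    contrapose! hx
    ext i
    simpa [hz] using congrArg (fun v : EuclideanSpace ℂ m => v i) hx
  have h1 := l2_opNorm_mulVec (N.map (fun x => (x : ℂ)))ᴴ z
  rw [l2_opNorm_conjTranspose] at h1
  have h2 := h1.trans_lt (mul_lt_of_lt_one_left hz0 hN)
  have h3 := pow_lt_pow_left₀ h2 (norm_nonneg _) two_ne_zero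
  have e : ∀ i, ((N.map (fun x => (x : ℂ)))ᴴ *ᵥ z.ofLp) i = ((Nᵀ *ᵥ x) i : ℝ) := by
    intro i
    simp [mulVec, dotProduct, hz]
  simp only [EuclideanSpace.norm_sq_eq] at h3
  have h4 : ∑ i, (Nᵀ *ᵥ x) i ^ 2 < ∑ i, x i ^ 2 := by
    change ∑ i, ‖((N.map (fun x => (x : ℂ)))ᴴ *ᵥ z.ofLp) i‖ ^ 2 < _ at h3
    simp only [e] at h3
    simpa [hz] using h3
  have e2 : x ⬝ᵥ (N * Nᵀ) *ᵥ x = ∑ i, (Nᵀ *ᵥ x) i ^ 2 := by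
    rw [← mulVec_mulVec, dotProduct_mulVec, ← mulVec_transpose]
    simp [dotProduct, sq]
  rw [star_trivial, sub_mulVec, dotProduct_sub, e2, one_mulVec, sub_pos]
  simpa [dotProduct, sq] using h4

/-- Discrete Lyapunov (Stein) inequality: a real matrix whose complex spectrum lies in the open
unit disc strictly contracts some positive definite form. -/
lemma Matrix.exists_posDef_stein (M : Matrix m m ℝ)
    (hM : ∀ z ∈ spectrum ℂ (M.map (fun x => (x : ℂ))), ‖z‖ < 1) :
    ∃ S : Matrix m m ℝ, S.PosDef ∧ (S - M * S * Mᵀ).PosDef := by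
  obtain ⟨k, hk, hlt⟩ := exists_norm_pow_lt_one _ hM
  have hpow : (M.map (fun x => (x : ℂ))) ^ k = (M ^ k).map (fun x => (x : ℂ)) :=
    (map_pow (RingHom.mapMatrix (m := m) Complex.ofRealHom) M k).symm
  rw [hpow] at hlt
  refine ⟨∑ j ∈ Finset.range k, M ^ j * (M ^ j)ᵀ, ?_, ?_⟩
  · obtain ⟨l, rfl⟩ := Nat.exists_eq_succ_of_ne_zero hk.ne'
    rw [Finset.sum_range_succ', add_comm]
    refine PosDef.add_posSemidef (by simpa using PosDef.one) (posSemidef_sum _ fun i _ => ?_)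
    simpa using posSemidef_self_mul_conjTranspose (M ^ (i + 1))
  · convert posDef_one_sub_mul_transpose _ hlt using 1
    rw [Finset.mul_sum, Finset.sum_mul, ← Finset.sum_sub_distrib]
    have := Finset.sum_range_sub' (fun j => M ^ j * (M ^ j)ᵀ) k
    simp only [pow_zero, transpose_one, mul_one] at this
    rw [← this]
    refine Finset.sum_congr rfl fun j _ => ?_
    rw [pow_succ' M j, transpose_mul]
    simp only [mul_assoc]

/-- The Cayley transform maps a matrix with spectrum in the open left half plane
to one with spectrum in the open unit disc. -/
lemma Matrix.norm_lt_one_of_mem_spectrum_cayley {F M : Matrix m m ℂ}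
    (hF : ∀ z ∈ spectrum ℂ F, z.re < 0) (hM : M * (1 - F) = 1 + F) :
    ∀ z ∈ spectrum ℂ M, ‖z‖ < 1 := by
  intro μ hμ
  by_contra! hge
  refine hμ ?_
  have key : (algebraMap ℂ (Matrix m m ℂ) μ - M) * (1 - F) =
      algebraMap ℂ (Matrix m m ℂ) (μ - 1) - (μ + 1) • F := by
    rw [sub_mul, hM, mul_sub, mul_one, ← Algebra.smul_def, map_sub, map_one]
    module
  have hu : IsUnit (algebraMap ℂ (Matrix m m ℂ) (μ - 1) - (μ + 1) • F) := by
    by_cases h1 : μ + 1 = 0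
    · rw [h1, zero_smul, sub_zero, show μ - 1 = -2 by linear_combination h1]
      exact (IsUnit.mk0 (-2 : ℂ) (by norm_num)).map _
    · have hnot : (μ - 1) / (μ + 1) ∉ spectrum ℂ F := fun hmem => by
        have h2 := hF _ hmem
        rw [Complex.div_re, ← add_div, div_lt_iff₀ (Complex.normSq_pos.mpr h1)] at h2
        have h3 : 1 ≤ ‖μ‖ ^ 2 := by nlinarith
        rw [← Complex.normSq_eq_norm_sq, Complex.normSq_apply] at h3
        simp at h2
        nlinarith
      rw [spectrum.notMem_iff] at hnot
      have h4 := ((IsUnit.mk0 _ h1).map (algebraMap ℂ (Matrix m m ℂ))).mul hnot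
      rwa [mul_sub, ← map_mul, mul_div_cancel₀ _ h1, ← Algebra.smul_def] at h4
  rw [← key, isUnit_iff_isUnit_det, det_mul] at hu
  exact (isUnit_iff_isUnit_det _).mpr (isUnit_of_mul_isUnit_left hu)

/-- Lyapunov inequality for a real Hurwitz matrix. -/
lemma Matrix.exists_posDef_lyapunov (F : Matrix m m ℝ)
    (hF : ∀ z ∈ spectrum ℂ (F.map (fun x => (x : ℂ))), z.re < 0) :
    ∃ P : Matrix m m ℝ, P.PosDef ∧ (-(F * P + P * Fᵀ)).PosDef := by
  let φ := RingHom.mapMatrix (m := m) Complex.ofRealHom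
  have hunit : IsUnit (1 - F) := by
    have h1 : IsUnit (φ (1 - F)) := by
      have : (1 : ℂ) ∉ spectrum ℂ (φ F) := fun h => by
        have := hF 1 h
        norm_num at this
      simpa [spectrum.notMem_iff] using this
    rw [isUnit_iff_isUnit_det, ← RingHom.map_det] at h1
    rw [isUnit_iff_isUnit_det, isUnit_iff_ne_zero]
    intro h0
    simp [h0] at h1
  obtain ⟨u, hu⟩ := hunit
  set G : Matrix m m ℝ := ↑u⁻¹ with hG
  have hG1 : G * (1 - F) = 1 := by rw [← hu, hG, Units.inv_mul]
  have hG2 : (1 - F) * G = 1 := by rw [← hu, hG, Units.mul_inv]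
  have hcomm : G * (1 + F) * (1 - F) = 1 + F := by
    have : (1 + F) * (1 - F) = (1 - F) * (1 + F) := by noncomm_ring
    rw [mul_assoc, this, ← mul_assoc, hG1, one_mul]
  obtain ⟨S, hS, hS'⟩ := exists_posDef_stein (G * (1 + F))
    (norm_lt_one_of_mem_spectrum_cayley hF
      (show φ (G * (1 + F)) * (1 - φ F) = 1 + φ F by simpa using congrArg φ hcomm))
  refine ⟨S, hS, ?_⟩
  have h := (hS'.mul_mul_conjTranspose_same (B := 1 - F)
    (vecMul_injective_of_isUnit ⟨u, hu⟩)).smul (show (0 : ℝ) < 1 / 2 by norm_num)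
  convert h using 1
  have e1 : (1 - F) * (G * (1 + F)) = 1 + F := by rw [← mul_assoc, hG2, one_mul]
  have e2 : (1 - F) * (S - G * (1 + F) * S * (G * (1 + F))ᵀ) * (1 - F)ᵀ =
      (1 - F) * S * (1 - F)ᵀ - (1 + F) * S * (1 + F)ᵀ := by
    conv_rhs => rw [← e1, transpose_mul (1 - F)]
    rw [mul_sub, sub_mul]
    simp only [Matrix.mul_assoc]
  rw [conjTranspose_eq_transpose_of_trivial, e2]
  simp only [transpose_sub, transpose_add, transpose_one, mul_sub, sub_mul, mul_add, add_mul,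
    mul_one, one_mul]
  module

/-- If `F = A - B K₀` satisfies the Lyapunov inequality with `P`, then a multiple of `P`
satisfies the dual Riccati inequality. -/
lemma Matrix.exists_posDef_dual_riccati {m l : Type*} [Fintype m] [Fintype l] {A P : Matrix m m ℝ}
    {B : Matrix m l ℝ} {K₀ : Matrix l m ℝ} (hP : P.PosDef)
    (hL : (-((A - B * K₀) * P + P * (A - B * K₀)ᵀ)).PosDef) {c : ℝ} (hc : 0 < c) :
    ∃ X : Matrix m m ℝ, X.PosDef ∧
      (c • (B * Bᵀ) - (A * X + X * Aᵀ) - c • (X * X)).PosDef := by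
  have hPt : Pᵀ = P := by simpa using hP.isHermitian.eq
  have hW : ((K₀ * P)ᵀ * (K₀ * P) + c ^ 2 • (P * P)).IsHermitian := by
    simp [IsHermitian, hPt]
  obtain ⟨s, hs, hQ⟩ := hL.exists_pos_sub_smul hW
  refine ⟨(c * s) • P, hP.smul (by positivity), ?_⟩
  have h := (hQ.add_posSemidef ((posSemidef_self_mul_conjTranspose
    (s⁻¹ • B - (K₀ * P)ᵀ)).smul hs.le)).smul (mul_pos hc hs)
  convert h using 1
  rw [conjTranspose_eq_transpose_of_trivial]
  simp only [transpose_sub, transpose_smul, transpose_mul, transpose_transpose, hPt, mul_sub,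
    sub_mul, Matrix.mul_sub, Matrix.sub_mul, Matrix.smul_mul, Matrix.mul_smul, smul_sub,
    smul_add, smul_smul, Matrix.mul_assoc]
  match_scalars <;> field_simp <;> ring

end Auxiliary

/-- If (A,B) is stabilizable then for any ς > 0 the Riccati inequality has a symmetric
    positive definite solution R, and with K = BᵀR the Lyapunov inequality holds for
    any η ≥ ς. -/
theorem riccati_inequality_of_stabilizable
    {n p : ℕ} (A : Matrix (Fin n) (Fin n) ℝ) (B : Matrix (Fin n) (Fin p) ℝ)
    (hstab : ∃ K₀ : Matrix (Fin p) (Fin n) ℝ,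
      ∀ lam ∈ spectrum ℂ ((A - B * K₀).map (fun x => (x : ℂ))), lam.re < 0)
    (ς : ℝ) (hς : 0 < ς) :
    ∃ R : Matrix (Fin n) (Fin n) ℝ, R.PosDef ∧ Rᵀ = R ∧
      ((-(ς • (1 : Matrix (Fin n) (Fin n) ℝ)))
        - (Aᵀ * R + R * A - ς • (R * B * Bᵀ * R))).PosDef ∧
      (∀ η : ℝ, ς ≤ η →
        ((-(ς • (1 : Matrix (Fin n) (Fin n) ℝ)))
          - (Aᵀ * R + R * A - η • (R * B * (Bᵀ * R)))).PosSemidef) := by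
  obtain ⟨K₀, hK⟩ := hstab
  obtain ⟨P, hP, hL⟩ := exists_posDef_lyapunov _ hK
  obtain ⟨X, hX, hH⟩ := exists_posDef_dual_riccati hP hL hς
  have hR := hX.inv
  have hRt : (X⁻¹)ᵀ = X⁻¹ := by simpa using hR.isHermitian.eq
  have hdet : IsUnit X.det := (isUnit_iff_isUnit_det _).mp hX.isUnit
  have hXR : X * X⁻¹ = 1 := mul_nonsing_inv _ hdet
  have hRX : X⁻¹ * X = 1 := nonsing_inv_mul _ hdet
  have hstrict : ((-(ς • (1 : Matrix (Fin n) (Fin n) ℝ)))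
      - (Aᵀ * X⁻¹ + X⁻¹ * A - ς • (X⁻¹ * B * Bᵀ * X⁻¹))).PosDef := by
    have h := hH.mul_mul_conjTranspose_same (B := X⁻¹) (vecMul_injective_of_isUnit hR.isUnit)
    convert h using 1
    have e1 : X⁻¹ * (A * X + X * Aᵀ) * X⁻¹ = X⁻¹ * A + Aᵀ * X⁻¹ := by
      rw [mul_add, add_mul, ← mul_assoc X⁻¹ X, hRX, one_mul, mul_assoc, mul_assoc A, hXR, mul_one]
    have e2 : X⁻¹ * (X * X) * X⁻¹ = 1 := by
      rw [← mul_assoc X⁻¹, hRX, one_mul, hXR]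
    rw [conjTranspose_eq_transpose_of_trivial, hRt, mul_sub, mul_sub, sub_mul, sub_mul, e1,
      mul_smul_comm, mul_smul_comm, smul_mul_assoc, smul_mul_assoc, e2]
    simp only [Matrix.mul_assoc]
    module
  refine ⟨X⁻¹, hR, hRt, hstrict, fun η hη => ?_⟩
  have h := hstrict.posSemidef.add
    ((posSemidef_self_mul_conjTranspose (X⁻¹ * B)).smul (sub_nonneg.mpr hη))
  convert h using 1
  rw [conjTranspose_eq_transpose_of_trivial, transpose_mul, hRt]
  simp only [Matrix.mul_assoc]
  module
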